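/- For every Young diagram λ, the normalized character on a 5-cycle satisfies Σ_5^λ = R_6^λ + 15·R_4^λ + 5·(R_2^λ)² + 8·R_2^λ (i.e., the Kerov polynomial K_5 equals R_6 + 15R_4 + 5R_2² + 8R_2). -/

import Mathlib

open scoped BigOperators

namespace AsympRep

/-- A fixed filling: the canonical bijection between `Fin μ.card` and the cells of `μ`. -/
noncomputable def fill (μ : YoungDiagram) : Fin μ.card ≃ {c // c ∈ μ.cells} :=
  (Fintype.equivFinOfCardEq (Fintype.card_coe _)).symm

/-- Row coordinate of the box occupied by `x` in the canonical filling. -/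
noncomputable def rowOf (μ : YoungDiagram) (x : Fin μ.card) : ℕ := (fill μ x).1.1

/-- Column coordinate of the box occupied by `x` in the canonical filling. -/
noncomputable def colOf (μ : YoungDiagram) (x : Fin μ.card) : ℕ := (fill μ x).1.2

/-- The Young symmetrizer `c_μ = a_μ * b_μ` in the group algebra `ℚ[S_n]`, `n = |μ|`,
where `a_μ` is the sum of the row-preserving permutations and `b_μ` is the signed sum
of the column-preserving permutations (for the canonical filling of `μ`). -/
noncomputable def youngSymmetrizer (μ : YoungDiagram) :
    MonoidAlgebra ℚ (Equiv.Perm (Fin μ.card)) :=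
  (∑ g : Equiv.Perm (Fin μ.card),
      if ∀ x, rowOf μ (g x) = rowOf μ x then MonoidAlgebra.single g (1 : ℚ) else 0) *
  (∑ g : Equiv.Perm (Fin μ.card),
      if ∀ x, colOf μ (g x) = colOf μ x
      then MonoidAlgebra.single g ((Equiv.Perm.sign g : ℤ) : ℚ) else 0)

/-- The Specht module: the left ideal `ℚ[S_n]·c_μ`, realizing the irreducible
representation `ρ^μ` of `S_n` (by left multiplication). -/
noncomputable def spechtModule (μ : YoungDiagram) :
    Submodule ℚ (MonoidAlgebra ℚ (Equiv.Perm (Fin μ.card))) :=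
  LinearMap.range (LinearMap.mulRight ℚ (youngSymmetrizer μ))

theorem spechtModule_invariant (μ : YoungDiagram) (π : Equiv.Perm (Fin μ.card)) :
    ∀ x ∈ spechtModule μ,
      (LinearMap.mulLeft ℚ (MonoidAlgebra.single π (1 : ℚ))) x ∈ spechtModule μ := by
  rintro x ⟨y, rfl⟩
  exact ⟨MonoidAlgebra.single π (1 : ℚ) * y, by
    simp only [LinearMap.mulRight_apply, LinearMap.mulLeft_apply, mul_assoc]⟩

/-- The irreducible character `χ^μ(π) = Tr ρ^μ(π)` of the symmetric group `S_n`,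
`n = |μ|`, computed as the trace of left multiplication by `π` on the Specht module. -/
noncomputable def irrChar (μ : YoungDiagram) (π : Equiv.Perm (Fin μ.card)) : ℚ :=
  LinearMap.trace ℚ (spechtModule μ)
    ((LinearMap.mulLeft ℚ (MonoidAlgebra.single π (1 : ℚ))).restrict
      (spechtModule_invariant μ π))

/-- The normalized character
`Σ_π^μ = n(n-1)⋯(n-k+1) · Tr ρ^μ(π) / Tr ρ^μ(e)` for `π ∈ S_k`, where `π` is regarded
as a permutation of `{1,…,n}` acting as the identity on `{k+1,…,n}`; it is `0` if `k > n`. -/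
noncomputable def normChar {k : ℕ} (μ : YoungDiagram) (π : Equiv.Perm (Fin k)) : ℚ :=
  if h : k ≤ μ.card then
    (μ.card.descFactorial k : ℚ)
      * irrChar μ (π.viaEmbedding (Fin.castLEEmb h)) / irrChar μ 1
  else 0

/-- `Σ_m^μ`: the normalized character on the `m`-cycle `(1,2,…,m) ∈ S_m`. -/
noncomputable def SigmaCycle (μ : YoungDiagram) (m : ℕ) : ℚ := normChar μ (finRotate m)

/-- The dilation `sμ` of a Young diagram: every box is replaced by an `s × s` grid
of boxes. -/
def dilate (μ : YoungDiagram) (s : ℕ) : YoungDiagram where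
  cells := (Finset.range (s * μ.colLen 0) ×ˢ Finset.range (s * μ.rowLen 0)).filter
      (fun c => (c.1 / s, c.2 / s) ∈ μ.cells)
  isLowerSet := by
    intro a b hba h
    simp only [Finset.coe_filter, Set.mem_setOf_eq, Finset.mem_product,
      Finset.mem_range] at h ⊢
    exact ⟨⟨lt_of_le_of_lt hba.1 h.1.1, lt_of_le_of_lt hba.2 h.1.2⟩,
      μ.isLowerSet (Prod.mk_le_mk.mpr
        ⟨Nat.div_le_div_right hba.1, Nat.div_le_div_right hba.2⟩) h.2⟩

open scoped Classical in
/-- The `k`-th free cumulant `R_k^μ`: the coefficient of `s^k` in the polynomial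
`s ↦ Σ_{k-1}^{sμ}`. -/
noncomputable def freeCumulant (μ : YoungDiagram) (k : ℕ) : ℚ :=
  if h : ∃ p : Polynomial ℚ, ∀ s : ℕ, 0 < s →
      SigmaCycle (dilate μ s) (k - 1) = Polynomial.eval (s : ℚ) p
  then h.choose.coeff k else 0

/-- `N^μ(σ₁,σ₂)`: the number of colorings of the cycles of `σ₁` (by column numbers)
and of the cycles of `σ₂` (by row numbers) compatible with `μ`.  A coloring of the
cycles is encoded as a pair of functions on points constant on the respective cycles;
compatibility means that for every point `a` the box in column `h₁(a)` and row `h₂(a)`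
belongs to `μ` (two cycles intersect precisely when they share a point). -/
noncomputable def Ncolorings {k : ℕ} (μ : YoungDiagram) (σ₁ σ₂ : Equiv.Perm (Fin k)) : ℕ :=
  Set.ncard {h : (Fin k → ℕ) × (Fin k → ℕ) |
    (∀ a, h.1 (σ₁ a) = h.1 a) ∧ (∀ a, h.2 (σ₂ a) = h.2 a) ∧
    ∀ a, (h.2 a, h.1 a) ∈ μ.cells }

/-- `|C(σ)|`: the number of cycles of a permutation (fixed points count as cycles),
i.e. the number of orbits. -/
noncomputable def numCycles {k : ℕ} (σ : Equiv.Perm (Fin k)) : ℕ :=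
  Set.ncard {s : Set (Fin k) | ∃ a, s = {b | σ.SameCycle a b}}

/-- The region of the plane occupied by the Young diagram `μ` drawn in the French
convention (row `i` of the diagram, `0`-indexed, occupies `[0, μ_i] × [i, i+1]`). -/
def frenchRegion (μ : YoungDiagram) : Set (ℝ × ℝ) :=
  {p | 0 ≤ p.1 ∧ 0 ≤ p.2 ∧ p.1 ≤ (μ.rowLen ⌊p.2⌋.toNat : ℝ)}

/-- The parameter `S_i^μ = (i-1) ∬_{(x,y)∈μ} (x-y)^{i-2} dx dy` (French convention). -/
noncomputable def Sparam (μ : YoungDiagram) (i : ℕ) : ℝ :=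
  ((i : ℝ) - 1) * ∫ p in frenchRegion μ, (p.1 - p.2) ^ (i - 2)

/-- The profile `ω : ℝ → ℝ` of a Young diagram: the boundary of the diagram drawn in
the Russian convention, i.e. the image of the French region under the rotation by `π/4`
composed with the dilation by `√2`, `(x, y) ↦ (x - y, x + y)`.  `ω(u)` is the largest
`v` with `(u,v)` in the rotated region, and `ω(u) = |u|` away from the diagram. -/
noncomputable def profile (μ : YoungDiagram) (u : ℝ) : ℝ :=
  max |u| (sSup {v : ℝ | ((u + v) / 2, (v - u) / 2) ∈ frenchRegion μ})

theorem fill_eq (μ : YoungDiagram) (x : Fin μ.card) :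
    ((fill μ x).1 : ℕ × ℕ) = (rowOf μ x, colOf μ x) := rfl

theorem rowOf_colOf_mem (μ : YoungDiagram) (x : Fin μ.card) :
    (rowOf μ x, colOf μ x) ∈ μ := (fill μ x).2

theorem rowOf_colOf_injective (μ : YoungDiagram) {x y : Fin μ.card}
    (hr : rowOf μ x = rowOf μ y) (hc : colOf μ x = colOf μ y) : x = y :=
  (fill μ).injective (Subtype.ext (by rw [fill_eq, fill_eq, hr, hc]))

theorem exists_rowOf_colOf (μ : YoungDiagram) {i j : ℕ} (h : (i, j) ∈ μ) :
    ∃ x, rowOf μ x = i ∧ colOf μ x = j :=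
  ⟨(fill μ).symm ⟨(i, j), h⟩, by simp [rowOf], by simp [colOf]⟩

/-- If no two points of a common column are sent by `g` to a common row, then every box
in the row of `g x` and the column of `x` belongs to `μ`. -/
theorem row_col_mem_of_separating (μ : YoungDiagram) (g : Equiv.Perm (Fin μ.card))
    (hg : ∀ x y, rowOf μ (g x) = rowOf μ (g y) → colOf μ x = colOf μ y → x = y)
    (x : Fin μ.card) : (rowOf μ (g x), colOf μ x) ∈ μ := by
  classical
  set φ : Fin μ.card → ℕ × ℕ := fun x => (rowOf μ (g x), colOf μ x) with hφ
  set ψ : Fin μ.card → ℕ × ℕ := fun x => (rowOf μ x, colOf μ x) with hψ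
  have hφi : Function.Injective φ := fun a b h => hg a b (Prod.ext_iff.1 h).1 (Prod.ext_iff.1 h).2
  have hψi : Function.Injective ψ := fun a b h =>
    rowOf_colOf_injective μ (Prod.ext_iff.1 h).1 (Prod.ext_iff.1 h).2
  set S := Finset.univ.image φ with hS
  have hμ : μ.cells = Finset.univ.image ψ := by
    ext ⟨i, j⟩
    simp only [Finset.mem_image, Finset.mem_univ, true_and, YoungDiagram.mem_cells]
    constructor
    · intro h
      obtain ⟨x, rfl, rfl⟩ := exists_rowOf_colOf μ h
      exact ⟨x, rfl⟩
    · rintro ⟨x, hx⟩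
      rw [← hx]
      exact rowOf_colOf_mem μ x
  let w : ℕ × ℕ → ℤ := fun c => (c.1 : ℤ) - μ.colLen c.2
  have hw : ∀ c, c ∈ μ.cells ↔ w c < 0 := by
    rintro ⟨i, j⟩
    rw [YoungDiagram.mem_cells, YoungDiagram.mem_iff_lt_colLen]
    simp [w]
  have hsum : ∑ c ∈ S, w c = ∑ c ∈ μ.cells, w c := by
    rw [hμ, hS, Finset.sum_image hφi.injOn, Finset.sum_image hψi.injOn]
    simp only [w, hφ, hψ, Finset.sum_sub_distrib]
    rw [Equiv.sum_comp g (fun x => (rowOf μ x : ℤ))]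
  have h1 := Finset.sum_sdiff_sub_sum_sdiff (s₁ := S) (s₂ := μ.cells) (f := w)
  have h2 : 0 ≤ ∑ c ∈ S \ μ.cells, w c := Finset.sum_nonneg fun c hc => by
    have := (Finset.mem_sdiff.1 hc).2
    rw [hw] at this
    exact not_lt.1 this
  have hcard : S.card = μ.cells.card := by
    rw [hμ, hS, Finset.card_image_of_injective _ hφi, Finset.card_image_of_injective _ hψi]
  have hsub : μ.cells ⊆ S := by
    rw [← Finset.sdiff_eq_empty_iff_subset]
    by_contra hne
    have : ∑ c ∈ μ.cells \ S, w c < 0 :=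
      Finset.sum_neg (fun c hc => (hw c).1 (Finset.mem_sdiff.1 hc).1)
        (Finset.nonempty_iff_ne_empty.2 hne)
    linarith
  have hSeq := Finset.eq_of_subset_of_card_le hsub hcard.le
  have : φ x ∈ μ.cells := by
    rw [hSeq]
    exact Finset.mem_image_of_mem _ (Finset.mem_univ x)
  exact this

/-- A permutation separating columns by rows is a product of a row-preserving and a
column-preserving permutation. -/
theorem exists_eq_row_mul_col (μ : YoungDiagram) (g : Equiv.Perm (Fin μ.card))
    (hg : ∀ x y, rowOf μ (g x) = rowOf μ (g y) → colOf μ x = colOf μ y → x = y) :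
    ∃ r c : Equiv.Perm (Fin μ.card), (∀ x, rowOf μ (r x) = rowOf μ x) ∧
      (∀ x, colOf μ (c x) = colOf μ x) ∧ g = r * c := by
  choose f hfr hfc using fun x => exists_rowOf_colOf μ (row_col_mem_of_separating μ g hg x)
  have hf : Function.Injective f := fun x y h =>
    hg x y (by rw [← hfr x, ← hfr y, h]) (by rw [← hfc x, ← hfc y, h])
  let c : Equiv.Perm (Fin μ.card) := Equiv.ofBijective f (Finite.injective_iff_bijective.1 hf)
  refine ⟨g * c⁻¹, c, fun x => ?_, hfc, by simp⟩
  have := hfr (c⁻¹ x)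
  have h2 : f (c⁻¹ x) = x := c.apply_symm_apply x
  rw [h2] at this
  simpa using this.symm

/-- The sum of the row-preserving permutations. -/
noncomputable def rowSum (μ : YoungDiagram) : MonoidAlgebra ℚ (Equiv.Perm (Fin μ.card)) :=
  ∑ g : Equiv.Perm (Fin μ.card),
      if ∀ x, rowOf μ (g x) = rowOf μ x then MonoidAlgebra.single g (1 : ℚ) else 0

/-- The signed sum of the column-preserving permutations. -/
noncomputable def colSum (μ : YoungDiagram) : MonoidAlgebra ℚ (Equiv.Perm (Fin μ.card)) :=
  ∑ g : Equiv.Perm (Fin μ.card),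
      if ∀ x, colOf μ (g x) = colOf μ x
      then MonoidAlgebra.single g ((Equiv.Perm.sign g : ℤ) : ℚ) else 0

theorem youngSymmetrizer_eq (μ : YoungDiagram) :
    youngSymmetrizer μ = rowSum μ * colSum μ := rfl

theorem rowSum_mul_single (μ : YoungDiagram) {r : Equiv.Perm (Fin μ.card)}
    (hr : ∀ x, rowOf μ (r x) = rowOf μ x) :
    rowSum μ * MonoidAlgebra.single r 1 = rowSum μ := by
  rw [rowSum, Finset.sum_mul]
  conv_rhs => rw [← Equiv.sum_comp (Equiv.mulRight r)]
  refine Finset.sum_congr rfl fun g _ => ?_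
  simp only [Equiv.coe_mulRight, ite_mul, zero_mul, MonoidAlgebra.single_mul_single, mul_one]
  simp only [Equiv.Perm.mul_apply]
  have : (∀ x, rowOf μ (g x) = rowOf μ x) ↔ ∀ x, rowOf μ (g (r x)) = rowOf μ x := by
    rw [← r.forall_congr_right (q := fun x => rowOf μ (g x) = rowOf μ x)]
    simp only [hr]
  exact if_congr this rfl rfl

theorem single_mul_colSum (μ : YoungDiagram) {c : Equiv.Perm (Fin μ.card)}
    (hc : ∀ x, colOf μ (c x) = colOf μ x) :
    MonoidAlgebra.single c 1 * colSum μ = ((Equiv.Perm.sign c : ℤ) : ℚ) • colSum μ := by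
  rw [colSum, Finset.mul_sum, Finset.smul_sum]
  conv_rhs => rw [← Equiv.sum_comp (Equiv.mulLeft c)]
  refine Finset.sum_congr rfl fun g _ => ?_
  simp only [Equiv.coe_mulLeft, mul_ite, mul_zero, MonoidAlgebra.single_mul_single, one_mul,
    smul_ite, smul_zero, MonoidAlgebra.smul_single, Equiv.Perm.mul_apply, hc]
  refine if_congr Iff.rfl ?_ rfl
  congr 1
  rcases Int.units_eq_one_or (Equiv.Perm.sign c) with h | h <;> simp [h]

theorem rowSum_mul_single_mul_colSum (μ : YoungDiagram) (g : Equiv.Perm (Fin μ.card)) :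
    ∃ k : ℚ, rowSum μ * MonoidAlgebra.single g 1 * colSum μ = k • youngSymmetrizer μ := by
  by_cases hg : ∀ x y, rowOf μ (g x) = rowOf μ (g y) → colOf μ x = colOf μ y → x = y
  · obtain ⟨r, c, hr, hc, rfl⟩ := exists_eq_row_mul_col μ g hg
    refine ⟨((Equiv.Perm.sign c : ℤ) : ℚ), ?_⟩
    have : MonoidAlgebra.single (r * c) (1 : ℚ) =
        MonoidAlgebra.single r 1 * MonoidAlgebra.single c 1 := by
      rw [MonoidAlgebra.single_mul_single, one_mul]
    rw [this, ← mul_assoc, rowSum_mul_single μ hr, mul_assoc, single_mul_colSum μ hc,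
      mul_smul_comm, youngSymmetrizer_eq]
  · push Not at hg
    obtain ⟨x, y, hrow, hcol, hne⟩ := hg
    refine ⟨0, ?_⟩
    have hr : ∀ z, rowOf μ (Equiv.swap (g x) (g y) z) = rowOf μ z := fun z => by
      rw [Equiv.swap_apply_def]
      split_ifs with h1 h2
      · rw [h1, hrow]
      · rw [h2, hrow]
      · rfl
    have hc : ∀ z, colOf μ (Equiv.swap x y z) = colOf μ z := fun z => by
      rw [Equiv.swap_apply_def]
      split_ifs with h1 h2
      · rw [h1, hcol]
      · rw [h2, hcol]
      · rfl
    have key : MonoidAlgebra.single (Equiv.swap (g x) (g y)) (1 : ℚ) *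
        MonoidAlgebra.single g 1 =
        MonoidAlgebra.single g 1 * MonoidAlgebra.single (Equiv.swap x y) 1 := by
      rw [MonoidAlgebra.single_mul_single, MonoidAlgebra.single_mul_single,
        Equiv.mul_swap_eq_swap_mul]
    have h : rowSum μ * MonoidAlgebra.single g 1 * colSum μ =
        -(rowSum μ * MonoidAlgebra.single g 1 * colSum μ) := by
      conv_lhs => rw [← rowSum_mul_single μ hr, mul_assoc (rowSum μ), key, mul_assoc, mul_assoc,
        single_mul_colSum μ hc, Equiv.Perm.sign_swap hne]
      simp [mul_assoc]
    rw [zero_smul]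
    have h2 := eq_neg_iff_add_eq_zero.1 h
    rw [← two_smul ℚ] at h2
    exact (smul_eq_zero.1 h2).resolve_left two_ne_zero

theorem rowSum_mul_mul_colSum (μ : YoungDiagram)
    (x : MonoidAlgebra ℚ (Equiv.Perm (Fin μ.card))) :
    ∃ k : ℚ, rowSum μ * x * colSum μ = k • youngSymmetrizer μ := by
  induction x using MonoidAlgebra.induction_linear with
  | zero => exact ⟨0, by simp⟩
  | add x y hx hy =>
    obtain ⟨k, hk⟩ := hx
    obtain ⟨l, hl⟩ := hy
    exact ⟨k + l, by rw [mul_add, add_mul, hk, hl, add_smul]⟩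
  | single g q =>
    obtain ⟨k, hk⟩ := rowSum_mul_single_mul_colSum μ g
    refine ⟨q * k, ?_⟩
    have : MonoidAlgebra.single g q = q • MonoidAlgebra.single g (1 : ℚ) := by simp
    rw [this, mul_smul_comm, smul_mul_assoc, hk, mul_smul]

theorem coeff_colSum (μ : YoungDiagram) (τ : Equiv.Perm (Fin μ.card)) :
    (colSum μ).coeff τ =
      if ∀ x, colOf μ (τ x) = colOf μ x then ((Equiv.Perm.sign τ : ℤ) : ℚ) else 0 := by
  classical
  rw [colSum, MonoidAlgebra.coeff_sum, Finsupp.finsetSum_apply, Finset.sum_eq_single τ]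
  · split_ifs <;> simp
  · intro g _ hg
    split_ifs
    · rw [MonoidAlgebra.coeff_single, Finsupp.single_apply, if_neg hg]
    · simp
  · simp

theorem coeff_youngSymmetrizer (μ : YoungDiagram) (τ : Equiv.Perm (Fin μ.card)) :
    (youngSymmetrizer μ).coeff τ = ∑ r : Equiv.Perm (Fin μ.card),
      if (∀ x, rowOf μ (r x) = rowOf μ x) ∧ (∀ x, colOf μ ((r⁻¹ * τ) x) = colOf μ x)
      then ((Equiv.Perm.sign (r⁻¹ * τ) : ℤ) : ℚ) else 0 := by
  rw [youngSymmetrizer_eq, rowSum, Finset.sum_mul, MonoidAlgebra.coeff_sum,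
    Finsupp.finsetSum_apply]
  refine Finset.sum_congr rfl fun r _ => ?_
  rw [ite_and, ite_mul, zero_mul]
  split_ifs with h1 h2
  · rw [MonoidAlgebra.coeff_single_mul_apply, one_mul, coeff_colSum, if_pos h2]
  · rw [MonoidAlgebra.coeff_single_mul_apply, one_mul, coeff_colSum, if_neg h2]
  · simp

theorem coeff_one_youngSymmetrizer (μ : YoungDiagram) : (youngSymmetrizer μ).coeff 1 = 1 := by
  rw [coeff_youngSymmetrizer, Finset.sum_eq_single 1]
  · simp
  · intro r _ hr
    refine if_neg fun h => hr ?_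
    ext x : 1
    refine rowOf_colOf_injective μ (h.1 x) ?_
    simpa using (h.2 (r x)).symm
  · simp

theorem trace_mulLeft_comp_mulRight {G : Type*} [Group G] [Fintype G] (π : G)
    (y : MonoidAlgebra ℚ G) :
    LinearMap.trace ℚ (MonoidAlgebra ℚ G)
      (LinearMap.mulLeft ℚ (MonoidAlgebra.single π 1) ∘ₗ LinearMap.mulRight ℚ y) =
      ∑ g : G, y.coeff (g⁻¹ * π⁻¹ * g) := by
  classical
  rw [LinearMap.trace_eq_matrix_trace ℚ (MonoidAlgebra.basis G ℚ), Matrix.trace]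
  refine Finset.sum_congr rfl fun g _ => ?_
  rw [Matrix.diag_apply, LinearMap.toMatrix_apply, MonoidAlgebra.basis_apply,
    LinearMap.comp_apply, LinearMap.mulRight_apply, LinearMap.mulLeft_apply]
  change (MonoidAlgebra.single π 1 * (MonoidAlgebra.single g 1 * y)).coeff g = _
  rw [MonoidAlgebra.coeff_single_mul_apply, MonoidAlgebra.coeff_single_mul_apply, one_mul,
    one_mul, mul_assoc]

/-- The irreducible character is proportional to the symmetrization of the coefficients of the
Young symmetrizer over conjugacy classes. -/
theorem exists_irrChar_eq (μ : YoungDiagram) : ∃ κ : ℚ, κ ≠ 0 ∧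
    ∀ π, irrChar μ π = κ * ∑ g, (youngSymmetrizer μ).coeff (g⁻¹ * π⁻¹ * g) := by
  obtain ⟨k, hk⟩ : ∃ k : ℚ, youngSymmetrizer μ * youngSymmetrizer μ =
      k • youngSymmetrizer μ := by
    obtain ⟨k, hk⟩ := rowSum_mul_mul_colSum μ (colSum μ * rowSum μ)
    exact ⟨k, by rw [← hk, youngSymmetrizer_eq]; simp only [mul_assoc]⟩
  have hk0 : k ≠ 0 := by
    rintro rfl
    rw [zero_smul] at hk
    have h1 := trace_mulLeft_comp_mulRight (1 : Equiv.Perm (Fin μ.card)) (youngSymmetrizer μ)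
    rw [← MonoidAlgebra.one_def, LinearMap.mulLeft_one, LinearMap.id_comp] at h1
    have h2 : IsNilpotent (LinearMap.mulRight ℚ (youngSymmetrizer μ)) :=
      ⟨2, by rw [pow_two, Module.End.mul_eq_comp, ← LinearMap.mulRight_mul, hk,
        LinearMap.mulRight_zero_eq_zero]⟩
    have h3 := (LinearMap.isNilpotent_trace_of_isNilpotent h2).eq_zero
    rw [h3] at h1
    simp only [inv_one, mul_one, inv_mul_cancel, coeff_one_youngSymmetrizer, Finset.sum_const,
      Finset.card_univ, Fintype.card_perm, Fintype.card_fin, nsmul_eq_mul] at h1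
    exact Nat.cast_ne_zero.2 (Nat.factorial_ne_zero _) h1.symm
  refine ⟨k⁻¹, inv_ne_zero hk0, fun π => ?_⟩
  rw [eq_inv_mul_iff_mul_eq₀ hk0, ← trace_mulLeft_comp_mulRight, irrChar, ← smul_eq_mul,
    ← LinearMap.map_smul]
  have hf : ∀ x, (LinearMap.mulLeft ℚ (MonoidAlgebra.single π 1) ∘ₗ
      LinearMap.mulRight ℚ (youngSymmetrizer μ)) x ∈ spechtModule μ := fun x =>
    spechtModule_invariant μ π _ ⟨x, rfl⟩
  rw [← LinearMap.trace_restrict_eq_of_forall_mem (spechtModule μ) _ hf]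
  congr 1
  ext ⟨x, y, rfl⟩ : 2
  simp [mul_assoc, hk]

/-- The signed number of factorizations `π = σ * (σ⁻¹ * π)` such that the filling `f` has rows
invariant under `σ` and columns invariant under `σ⁻¹ * π`. -/
noncomputable def factorizationWeight {k : ℕ} (μ : YoungDiagram) (π : Equiv.Perm (Fin k))
    (f : Fin k → Fin μ.card) : ℚ :=
  ∑ σ : Equiv.Perm (Fin k),
    if (∀ a, rowOf μ (f (σ a)) = rowOf μ (f a)) ∧
      (∀ a, colOf μ (f ((σ⁻¹ * π) a)) = colOf μ (f a))
    then ((Equiv.Perm.sign (σ⁻¹ * π) : ℤ) : ℚ) else 0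

theorem sum_coeff_youngSymmetrizer_conj (μ : YoungDiagram) (τ : Equiv.Perm (Fin μ.card)) :
    ∑ g : Equiv.Perm (Fin μ.card), (youngSymmetrizer μ).coeff (g⁻¹ * τ * g) =
      ∑ g : Equiv.Perm (Fin μ.card), factorizationWeight μ τ g := by
  rw [← Equiv.sum_comp (Equiv.inv _)]
  refine Finset.sum_congr rfl fun g _ => ?_
  rw [coeff_youngSymmetrizer, factorizationWeight, ← Equiv.sum_comp (MulAut.conj g).toEquiv]
  refine Finset.sum_congr rfl fun ρ _ => ?_
  have hconj : ((MulAut.conj g).toEquiv ρ)⁻¹ * ((Equiv.inv _ g)⁻¹ * τ * Equiv.inv _ g) =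
      g * (ρ⁻¹ * τ) * g⁻¹ := by
    simp [mul_assoc]
  rw [hconj]
  refine if_congr (and_congr ?_ ?_) ?_ rfl
  · rw [← g.forall_congr_right]
    simp
  · rw [← g.forall_congr_right]
    simp
  · simp only [Equiv.Perm.sign_mul, Equiv.Perm.sign_inv]
    rw [mul_right_comm, Int.units_mul_self, one_mul]

theorem exists_viaEmbedding_eq {k n : ℕ} (e : Fin k ↪ Fin n) (ρ : Equiv.Perm (Fin n))
    (h : ∀ x, x ∉ Set.range e → ρ x = x) : ∃ σ : Equiv.Perm (Fin k), σ.viaEmbedding e = ρ := by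
  have hmem : ∀ a, ρ (e a) ∈ Set.range e := fun a => by
    by_contra hx
    exact hx ⟨a, (ρ.injective (h _ hx)).symm⟩
  choose f hf using hmem
  have hinj : Function.Injective f := fun a b hab =>
    e.injective (ρ.injective (by rw [← hf, ← hf, hab]))
  refine ⟨Equiv.ofBijective f (Finite.injective_iff_bijective.1 hinj), ?_⟩
  ext x : 1
  by_cases hx : x ∈ Set.range e
  · obtain ⟨a, rfl⟩ := hx
    rw [Equiv.Perm.viaEmbedding_apply, Equiv.ofBijective_apply, hf]
  · rw [Equiv.Perm.viaEmbedding_apply_of_notMem _ _ _ hx, h x hx]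

theorem sign_viaEmbedding {k n : ℕ} (e : Fin k ↪ Fin n) (σ : Equiv.Perm (Fin k)) :
    Equiv.Perm.sign (σ.viaEmbedding e) = Equiv.Perm.sign σ := by
  let _ : DecidablePred (· ∈ Set.range e) := Classical.decPred _
  exact Equiv.Perm.sign_extendDomain σ (Equiv.ofInjective e.1 e.2)

theorem factorizationWeight_viaEmbedding {k : ℕ} (μ : YoungDiagram) (π : Equiv.Perm (Fin k))
    (e : Fin k ↪ Fin μ.card) (g : Equiv.Perm (Fin μ.card)) :
    factorizationWeight μ (π.viaEmbedding e) g = factorizationWeight μ π (g ∘ e) := by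
  rw [factorizationWeight, factorizationWeight]
  symm
  have hprod : ∀ σ : Equiv.Perm (Fin k),
      (σ.viaEmbedding e)⁻¹ * π.viaEmbedding e = (σ⁻¹ * π).viaEmbedding e := fun σ => by
    simp only [← Equiv.Perm.viaEmbeddingHom_apply, map_mul, map_inv]
  have hinv : ∀ (p : Fin μ.card → ℕ) (σ : Equiv.Perm (Fin k)),
      (∀ a, p ((g ∘ e) (σ a)) = p ((g ∘ e) a)) ↔
        ∀ x, p (g (σ.viaEmbedding e x)) = p (g x) := fun p σ => by
    constructor
    · intro h x
      by_cases hx : x ∈ Set.range e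
      · obtain ⟨a, rfl⟩ := hx
        rw [Equiv.Perm.viaEmbedding_apply]
        exact h a
      · rw [Equiv.Perm.viaEmbedding_apply_of_notMem _ _ _ hx]
    · intro h a
      have := h (e a)
      rwa [Equiv.Perm.viaEmbedding_apply] at this
  refine Finset.sum_of_injOn (fun σ => σ.viaEmbedding e)
    ((Equiv.Perm.viaEmbeddingHom_injective e).injOn) (by simp) ?_ ?_
  · intro ρ _ hρ
    refine if_neg fun h => hρ ?_
    have hfix : ∀ x, x ∉ Set.range e → ρ x = x := fun x hx => by
      have hτ : ρ ((ρ⁻¹ * π.viaEmbedding e) x) = x := by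
        rw [← Equiv.Perm.mul_apply, mul_inv_cancel_left,
          Equiv.Perm.viaEmbedding_apply_of_notMem _ _ _ hx]
      have h1 := h.1 ((ρ⁻¹ * π.viaEmbedding e) x)
      rw [hτ] at h1
      have h2 := g.injective (rowOf_colOf_injective μ h1.symm (h.2 x))
      rwa [h2] at hτ
    obtain ⟨σ, hσ⟩ := exists_viaEmbedding_eq e ρ hfix
    exact ⟨σ, by simp, hσ⟩
  · intro σ _
    rw [hprod, sign_viaEmbedding]
    exact if_congr (and_congr (hinv _ _) (hinv _ _)) rfl rfl

/-- Averaging over permutations of the target amounts to averaging over all embeddings. -/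
theorem descFactorial_mul_sum_perm {k n : ℕ} (e : Fin k ↪ Fin n) (W : (Fin k → Fin n) → ℚ) :
    (n.descFactorial k : ℚ) * ∑ g : Equiv.Perm (Fin n), W (g ∘ e) =
      n.factorial * ∑ f : Fin k ↪ Fin n, W f := by
  have h1 : ∀ f : Fin k ↪ Fin n, ∑ g : Equiv.Perm (Fin n), W (g ∘ f) =
      ∑ g : Equiv.Perm (Fin n), W (g ∘ e) := fun f => by
    obtain ⟨h, hh⟩ := Equiv.Perm.exists_extending_pair e f e.injective f.injective
    conv_rhs => rw [← Equiv.sum_comp (Equiv.mulRight h)]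
    refine Finset.sum_congr rfl fun g _ => congrArg W ?_
    ext a
    simp [← hh]
  have h2 : ∑ f : Fin k ↪ Fin n, ∑ g : Equiv.Perm (Fin n), W (g ∘ f) =
      n.factorial * ∑ f : Fin k ↪ Fin n, W f := by
    rw [Finset.sum_comm]
    have : ∀ g : Equiv.Perm (Fin n), ∑ f : Fin k ↪ Fin n, W (g ∘ f) =
        ∑ f : Fin k ↪ Fin n, W f := fun g =>
      Fintype.sum_equiv (Equiv.embeddingCongr (Equiv.refl _) g) _ _ fun f => congrArg W (by
        ext a
        simp [Equiv.embeddingCongr])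
    simp [this, Fintype.card_perm]
  rw [← h2, Finset.sum_congr rfl fun f _ => h1 f]
  simp [Fintype.card_embedding_eq]

theorem factorizationWeight_eq_zero {k : ℕ} (μ : YoungDiagram) (π : Equiv.Perm (Fin k))
    {f : Fin k → Fin μ.card} (hf : ¬ Function.Injective f) : factorizationWeight μ π f = 0 := by
  simp only [Function.Injective, not_forall] at hf
  obtain ⟨a, b, hab, hne⟩ := hf
  have hswap : ∀ x, f (Equiv.swap a b x) = f x := fun x => by
    rw [Equiv.swap_apply_def]
    split_ifs with h1 h2
    · rw [h1, hab]
    · rw [h2, hab]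
    · rfl
  have h : factorizationWeight μ π f = -factorizationWeight μ π f := by
    conv_lhs => rw [factorizationWeight, ← Equiv.sum_comp (Equiv.mulRight (Equiv.swap a b))]
    rw [factorizationWeight, ← Finset.sum_neg_distrib]
    refine Finset.sum_congr rfl fun σ _ => ?_
    have hrow : (∀ x, rowOf μ (f ((σ * Equiv.swap a b) x)) = rowOf μ (f x)) ↔
        ∀ x, rowOf μ (f (σ x)) = rowOf μ (f x) := by
      rw [← (Equiv.swap a b).forall_congr_right (q := fun x => rowOf μ (f (σ x)) = rowOf μ (f x))]
      simp [hswap]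
    rw [neg_ite, neg_zero, Equiv.coe_mulRight]
    refine if_congr (and_congr hrow ?_) ?_ rfl
    · simp [hswap]
    · simp [Equiv.Perm.sign_swap hne]
  linarith

theorem card_filter_eq_Ncolorings {k : ℕ} (μ : YoungDiagram) (σ τ : Equiv.Perm (Fin k)) :
    (Finset.univ.filter fun f : Fin k → Fin μ.card =>
      (∀ a, rowOf μ (f (σ a)) = rowOf μ (f a)) ∧
        ∀ a, colOf μ (f (τ a)) = colOf μ (f a)).card = Ncolorings μ τ σ := by
  rw [Ncolorings, ← Set.ncard_coe_finset]
  refine Set.ncard_congr (fun f _ => (fun a => colOf μ (f a), fun a => rowOf μ (f a))) ?_ ?_ ?_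
  · intro f hf
    simp only [Finset.coe_filter, Finset.mem_univ, true_and, Set.mem_ofPred_eq] at hf
    exact ⟨hf.2, hf.1, fun a => rowOf_colOf_mem μ (f a)⟩
  · intro f f' _ _ h
    ext a : 1
    exact rowOf_colOf_injective μ (congrFun (congrArg Prod.snd h) a)
      (congrFun (congrArg Prod.fst h) a)
  · rintro ⟨h₁, h₂⟩ ⟨hτ, hσ, hμ⟩
    choose f hf₂ hf₁ using fun a => exists_rowOf_colOf μ (hμ a)
    refine ⟨f, ?_, Prod.ext (funext hf₁) (funext hf₂)⟩
    simp only [Finset.coe_filter, Finset.mem_univ, true_and, Set.mem_ofPred_eq]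
    exact ⟨fun a => by rw [hf₂, hf₂]; exact hσ a, fun a => by rw [hf₁, hf₁]; exact hτ a⟩

/-- The Stanley–Féray character formula. -/
theorem normChar_eq_sum_Ncolorings {k : ℕ} (μ : YoungDiagram) (π : Equiv.Perm (Fin k)) :
    normChar μ π = ∑ σ : Equiv.Perm (Fin k),
      ((Equiv.Perm.sign (σ⁻¹ * π⁻¹) : ℤ) : ℚ) * Ncolorings μ (σ⁻¹ * π⁻¹) σ := by
  have hsum : ∑ f : Fin k → Fin μ.card, factorizationWeight μ π⁻¹ f =
      ∑ σ : Equiv.Perm (Fin k),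
        ((Equiv.Perm.sign (σ⁻¹ * π⁻¹) : ℤ) : ℚ) * Ncolorings μ (σ⁻¹ * π⁻¹) σ := by
    simp only [factorizationWeight]
    rw [Finset.sum_comm]
    refine Finset.sum_congr rfl fun σ _ => ?_
    rw [← card_filter_eq_Ncolorings, ← Finset.sum_filter, Finset.sum_const, nsmul_eq_mul,
      mul_comm]
  rw [← hsum, normChar]
  split_ifs with hk
  · obtain ⟨κ, hκ, hχ⟩ := exists_irrChar_eq μ
    have hinj : ∑ f : Fin k → Fin μ.card, factorizationWeight μ π⁻¹ f =
        ∑ f : Fin k ↪ Fin μ.card, factorizationWeight μ π⁻¹ f := by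
      symm
      refine Finset.sum_of_injOn (fun f => (f : Fin k → Fin μ.card))
        DFunLike.coe_injective.injOn (by simp) ?_ fun _ _ => rfl
      intro f _ hf
      exact factorizationWeight_eq_zero μ _ fun h => hf ⟨⟨f, h⟩, by simp, rfl⟩
    have hone : irrChar μ 1 = κ * μ.card.factorial := by
      rw [hχ]
      simp [coeff_one_youngSymmetrizer, Fintype.card_perm]
    have hπ : (π.viaEmbedding (Fin.castLEEmb hk))⁻¹ = π⁻¹.viaEmbedding (Fin.castLEEmb hk) := by
      simp only [← Equiv.Perm.viaEmbeddingHom_apply, map_inv]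
    have hn : (μ.card.factorial : ℚ) ≠ 0 := Nat.cast_ne_zero.2 (Nat.factorial_ne_zero _)
    rw [hone, hχ, hinj, sum_coeff_youngSymmetrizer_conj, hπ,
      div_eq_iff (mul_ne_zero hκ hn), mul_left_comm]
    simp only [factorizationWeight_viaEmbedding]
    rw [descFactorial_mul_sum_perm]
    ring
  · refine (Finset.sum_eq_zero fun f _ => factorizationWeight_eq_zero μ _ fun hf => hk ?_).symm
    simpa using Fintype.card_le_of_injective f hf

/-- The least point of the cycle of `a` under `σ`, used as a label of this cycle. -/
def cycleLabel {k : ℕ} (σ : Equiv.Perm (Fin k)) (a : Fin k) : Option (Fin k) :=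
  (List.finRange k).find? fun b => σ.SameCycle a b

theorem cycleLabel_eq_iff {k : ℕ} (σ : Equiv.Perm (Fin k)) (a b : Fin k) :
    cycleLabel σ a = cycleLabel σ b ↔ σ.SameCycle a b := by
  constructor
  · intro h
    cases hc : cycleLabel σ a with
    | none =>
      have := List.find?_eq_none.1 hc a (List.mem_finRange a)
      simp [Equiv.Perm.SameCycle.refl] at this
    | some c =>
      have h1 := List.find?_some hc
      have h2 := List.find?_some (h.symm.trans hc)
      simp only [decide_eq_true_eq] at h1 h2
      exact h1.trans h2.symm
  · intro h
    have : ∀ c, σ.SameCycle a c ↔ σ.SameCycle b c := fun c => ⟨h.symm.trans, h.trans⟩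
    simp [cycleLabel, this]

/-- The number of cycles of `σ`, fixed points included. -/
def cycleCount {k : ℕ} (σ : Equiv.Perm (Fin k)) : ℕ :=
  (Finset.univ.image (cycleLabel σ)).card

/-- The number of pairs consisting of a cycle of `σ` and a cycle of `τ` that intersect. -/
def edgeCount {k : ℕ} (σ τ : Equiv.Perm (Fin k)) : ℕ :=
  (Finset.univ.image fun a => (cycleLabel σ a, cycleLabel τ a)).card

/-- `u` identifies the set of cycles of `σ` with `ι`. -/
def IsCycleLabelling {k : ℕ} {ι : Type*} (σ : Equiv.Perm (Fin k)) (u : Fin k → ι) : Prop :=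
  Function.Surjective u ∧ ∀ a b, u a = u b ↔ σ.SameCycle a b

theorem exists_isCycleLabelling {k p : ℕ} (σ : Equiv.Perm (Fin k)) (h : cycleCount σ = p) :
    ∃ u : Fin k → Fin p, IsCycleLabelling σ u := by
  let ε := Finset.equivFinOfCardEq h
  refine ⟨fun a => ε ⟨cycleLabel σ a, Finset.mem_image_of_mem _ (Finset.mem_univ a)⟩, ?_, ?_⟩
  · intro i
    obtain ⟨a, -, ha⟩ := Finset.mem_image.1 (ε.symm i).2
    exact ⟨a, by simp [ha]⟩
  · intro a b
    rw [ε.apply_eq_iff_eq, Subtype.mk.injEq, cycleLabel_eq_iff]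

theorem IsCycleLabelling.exists_lift {k : ℕ} {ι : Type*} {σ : Equiv.Perm (Fin k)} {u : Fin k → ι}
    (hu : IsCycleLabelling σ u) {h : Fin k → ℕ} (hh : ∀ a, h (σ a) = h a) :
    ∃ x : ι → ℕ, ∀ a, x (u a) = h a := by
  have hpow : ∀ (n : ℕ) (a : Fin k), h ((σ ^ n) a) = h a := fun n a => by
    induction n with
    | zero => rfl
    | succ n ih => rw [pow_succ', Equiv.Perm.mul_apply, hh, ih]
  have hinv : ∀ a b, u a = u b → h a = h b := fun a b hab => by
    obtain ⟨n, -, rfl⟩ := ((hu.2 a b).1 hab).exists_pow_eq'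
    exact (hpow n a).symm
  choose r hr using hu.1
  exact ⟨fun i => h (r i), fun a => hinv _ _ (hr _)⟩

/-- Pairs of colorings of the two vertex classes of a bipartite graph by rows and by columns
such that every edge is mapped into `μ`. -/
def graphColorings (μ : YoungDiagram) {ι κ : Type*} (E : Set (ι × κ)) :
    Set ((ι → ℕ) × (κ → ℕ)) :=
  {h | ∀ e ∈ E, (h.1 e.1, h.2 e.2) ∈ μ}

theorem Ncolorings_eq_ncard {k : ℕ} {ι κ : Type*} (μ : YoungDiagram) {σ τ : Equiv.Perm (Fin k)}
    {u : Fin k → ι} {v : Fin k → κ} (hu : IsCycleLabelling σ u) (hv : IsCycleLabelling τ v) :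
    Ncolorings μ τ σ = (graphColorings μ (Set.range fun a => (u a, v a))).ncard := by
  symm
  refine Set.ncard_congr (fun h _ => (h.2 ∘ v, h.1 ∘ u)) ?_ ?_ ?_
  · intro h hh
    refine ⟨fun a => congrArg h.2 ((hv.2 _ _).2 ?_), fun a => congrArg h.1 ((hu.2 _ _).2 ?_),
      fun a => hh _ ⟨a, rfl⟩⟩ <;>
    exact Equiv.Perm.sameCycle_apply_left.2 (Equiv.Perm.SameCycle.refl _ _)
  · intro h h' _ _ heq
    exact Prod.ext (hu.1.injective_comp_right (congrArg Prod.snd heq))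
      (hv.1.injective_comp_right (congrArg Prod.fst heq))
  · rintro ⟨h₁, h₂⟩ ⟨hτ, hσ, hμ⟩
    obtain ⟨x, hx⟩ := hu.exists_lift hσ
    obtain ⟨y, hy⟩ := hv.exists_lift hτ
    refine ⟨(x, y), ?_, Prod.ext (funext hy) (funext hx)⟩
    rintro _ ⟨a, rfl⟩
    simp only [hx, hy]
    exact hμ a

theorem mem_dilate (μ : YoungDiagram) {s : ℕ} (hs : 0 < s) (i j : ℕ) :
    (i, j) ∈ dilate μ s ↔ (i / s, j / s) ∈ μ := by
  rw [← YoungDiagram.mem_cells, ← YoungDiagram.mem_cells, dilate]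
  simp only [Finset.mem_filter, Finset.mem_product, Finset.mem_range, and_iff_right_iff_imp]
  intro h
  have h1 := YoungDiagram.mem_iff_lt_colLen.1 (μ.up_left_mem le_rfl (Nat.zero_le _) h)
  have h2 := YoungDiagram.mem_iff_lt_rowLen.1 (μ.up_left_mem (Nat.zero_le _) le_rfl h)
  rw [Nat.div_lt_iff_lt_mul hs, mul_comm] at h1 h2
  exact ⟨h1, h2⟩

theorem ncard_graphColorings_dilate (μ : YoungDiagram) {p q s : ℕ} (hs : 0 < s)
    (E : Set (Fin p × Fin q)) :
    (graphColorings (dilate μ s) E).ncard = s ^ (p + q) * (graphColorings μ E).ncard := by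
  have : NeZero s := ⟨hs.ne'⟩
  let D (m : ℕ) : (Fin m → ℕ) ≃ (Fin m → ℕ) × (Fin m → Fin s) :=
    (Equiv.arrowCongr (Equiv.refl _) (Nat.divModEquiv s)).trans (Equiv.arrowProdEquivProdArrow _ _ _)
  let Φ := ((D p).prodCongr (D q)).trans (Equiv.prodProdProdComm _ _ _ _)
  have hpre : graphColorings (dilate μ s) E =
      Φ ⁻¹' (graphColorings μ E ×ˢ (Set.univ : Set ((Fin p → Fin s) × (Fin q → Fin s)))) := by
    ext h
    simp only [graphColorings, Set.mem_preimage, Set.mem_prod, Set.mem_univ, and_true,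
      Set.mem_ofPred_eq, mem_dilate μ hs]
    rfl
  rw [hpre, Set.ncard_preimage_of_injective_subset_range Φ.injective (by simp), Set.ncard_prod,
    Set.ncard_univ, Nat.card_eq_fintype_card]
  simp [pow_add, mul_comm]

theorem Ncolorings_dilate {k : ℕ} (μ : YoungDiagram) {s : ℕ} (hs : 0 < s)
    (σ τ : Equiv.Perm (Fin k)) :
    Ncolorings (dilate μ s) τ σ = s ^ (cycleCount σ + cycleCount τ) * Ncolorings μ τ σ := by
  obtain ⟨u, hu⟩ := exists_isCycleLabelling σ rfl
  obtain ⟨v, hv⟩ := exists_isCycleLabelling τ rfl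
  rw [Ncolorings_eq_ncard _ hu hv, Ncolorings_eq_ncard _ hu hv, ncard_graphColorings_dilate μ hs]

theorem SigmaCycle_eq_sum (μ : YoungDiagram) (m : ℕ) :
    SigmaCycle μ m = ∑ σ : Equiv.Perm (Fin m),
      ((Equiv.Perm.sign (σ⁻¹ * (finRotate m)⁻¹) : ℤ) : ℚ) *
        Ncolorings μ (σ⁻¹ * (finRotate m)⁻¹) σ :=
  normChar_eq_sum_Ncolorings μ (finRotate m)

theorem freeCumulant_eq_sum (μ : YoungDiagram) (k : ℕ) :
    freeCumulant μ k = ∑ σ : Equiv.Perm (Fin (k - 1)),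
      if cycleCount σ + cycleCount (σ⁻¹ * (finRotate (k - 1))⁻¹) = k then
        ((Equiv.Perm.sign (σ⁻¹ * (finRotate (k - 1))⁻¹) : ℤ) : ℚ) *
          Ncolorings μ (σ⁻¹ * (finRotate (k - 1))⁻¹) σ
      else 0 := by
  let P : Polynomial ℚ := ∑ σ : Equiv.Perm (Fin (k - 1)),
    Polynomial.C (((Equiv.Perm.sign (σ⁻¹ * (finRotate (k - 1))⁻¹) : ℤ) : ℚ) *
      Ncolorings μ (σ⁻¹ * (finRotate (k - 1))⁻¹) σ) *
    Polynomial.X ^ (cycleCount σ + cycleCount (σ⁻¹ * (finRotate (k - 1))⁻¹))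
  have hP : ∀ s : ℕ, 0 < s →
      SigmaCycle (dilate μ s) (k - 1) = Polynomial.eval (s : ℚ) P := fun s hs => by
    rw [SigmaCycle_eq_sum, Polynomial.eval_finsetSum]
    refine Finset.sum_congr rfl fun σ _ => ?_
    rw [Ncolorings_dilate μ hs]
    simp only [Polynomial.eval_mul, Polynomial.eval_C, Polynomial.eval_pow, Polynomial.eval_X]
    push_cast
    ring
  have hex : ∃ p : Polynomial ℚ, ∀ s : ℕ, 0 < s →
      SigmaCycle (dilate μ s) (k - 1) = Polynomial.eval (s : ℚ) p := ⟨P, hP⟩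
  have hchoose : hex.choose = P := by
    refine Polynomial.eq_of_infinite_eval_eq _ _ (Set.Infinite.mono ?_
      ((Set.Ioi_infinite 0).image (Nat.cast_injective (R := ℚ)).injOn))
    rintro _ ⟨s, hs, rfl⟩
    exact (hex.choose_spec s hs).symm.trans (hP s hs)
  rw [freeCumulant, dif_pos hex, hchoose, Polynomial.finsetSum_coeff]
  refine Finset.sum_congr rfl fun σ _ => ?_
  rw [Polynomial.coeff_C_mul_X_pow]
  simp only [eq_comm]

/-- The number of colorings of the complete bipartite graph `K_{p,q}`. -/
noncomputable def completeCount (μ : YoungDiagram) (p q : ℕ) : ℕ :=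
  (graphColorings μ (Set.univ : Set (Fin p × Fin q))).ncard

/-- The number of colorings of a path with three edges, the complete bipartite graph `K_{2,2}`
without one edge. -/
noncomputable def pathCount (μ : YoungDiagram) : ℕ :=
  (graphColorings μ ({(0, 0)}ᶜ : Set (Fin 2 × Fin 2))).ncard

theorem ncard_graphColorings_reindex (μ : YoungDiagram) {ι κ : Type*} (α : Equiv.Perm ι)
    (β : Equiv.Perm κ) (E : Set (ι × κ)) :
    (graphColorings μ ((α.prodCongr β) ⁻¹' E)).ncard = (graphColorings μ E).ncard := by
  symm
  let Φ : ((ι → ℕ) × (κ → ℕ)) ≃ ((ι → ℕ) × (κ → ℕ)) :=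
    (Equiv.arrowCongr α (Equiv.refl _)).prodCongr (Equiv.arrowCongr β (Equiv.refl _))
  have : graphColorings μ ((α.prodCongr β) ⁻¹' E) = Φ ⁻¹' graphColorings μ E := by
    ext h
    simp only [graphColorings, Set.mem_preimage, Set.mem_ofPred_eq]
    conv_rhs => rw [← (α.prodCongr β).forall_congr_right]
    simp [Φ]
  rw [this, Set.ncard_preimage_of_injective_subset_range Φ.injective (by simp)]

theorem ncard_graphColorings_compl_singleton (μ : YoungDiagram) (e : Fin 2 × Fin 2) :
    (graphColorings μ ({e}ᶜ : Set (Fin 2 × Fin 2))).ncard = pathCount μ := by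
  rw [pathCount, ← ncard_graphColorings_reindex μ (Equiv.swap 0 e.1) (Equiv.swap 0 e.2)]
  congr 2
  ext x
  simp [Prod.ext_iff, Equiv.swap_apply_eq_iff]

theorem card_completeCount_inclusion_exclusion (μ : YoungDiagram) :
    completeCount μ 2 2 + completeCount μ 1 1 ^ 2 = 2 * pathCount μ := by
  let F : ((Fin 2 → ℕ) × (Fin 2 → ℕ)) ≃ (ℕ × ℕ) × (ℕ × ℕ) :=
    ((finTwoArrowEquiv ℕ).prodCongr (finTwoArrowEquiv ℕ)).trans (Equiv.prodProdProdComm _ _ _ _)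
  let G : ((Fin 1 → ℕ) × (Fin 1 → ℕ)) ≃ ℕ × ℕ :=
    (Equiv.funUnique (Fin 1) ℕ).prodCongr (Equiv.funUnique (Fin 1) ℕ)
  have hG : completeCount μ 1 1 = μ.cells.card := by
    have : graphColorings μ (Set.univ : Set (Fin 1 × Fin 1)) = G ⁻¹' μ.cells := by
      ext h
      simp [graphColorings, G]
      rfl
    rw [completeCount, this,
      Set.ncard_preimage_of_injective_subset_range G.injective (by simp), Set.ncard_coe_finset]
  let U₁ := graphColorings μ ({(1, 0)}ᶜ : Set (Fin 2 × Fin 2))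
  let U₂ := graphColorings μ ({(0, 1)}ᶜ : Set (Fin 2 × Fin 2))
  have hinter : U₁ ∩ U₂ = graphColorings μ (Set.univ : Set (Fin 2 × Fin 2)) := by
    ext h
    simp [U₁, U₂, graphColorings, Fin.forall_fin_two]
    tauto
  have hunion : U₁ ∪ U₂ = F ⁻¹' (μ.cells ×ˢ μ.cells : Finset _) := by
    ext h
    simp only [U₁, U₂, graphColorings, Set.mem_union, Set.mem_ofPred_eq, Set.mem_compl_iff,
      Set.mem_singleton_iff, Prod.forall, Fin.forall_fin_two, Prod.mk.injEq, Set.mem_preimage,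
      Finset.coe_product, Set.mem_prod, SetLike.mem_coe, YoungDiagram.mem_cells]
    simp [F]
    have h1 : (h.1 0, h.2 0) ∈ μ → (h.1 1, h.2 1) ∈ μ →
        (h.1 0, h.2 1) ∈ μ ∨ (h.1 1, h.2 0) ∈ μ := fun h0 h1 => by
      rcases le_total (h.1 0) (h.1 1) with hle | hle
      · exact Or.inl (μ.up_left_mem hle le_rfl h1)
      · exact Or.inr (μ.up_left_mem hle le_rfl h0)
    tauto
  have hfin : (U₁ ∪ U₂).Finite := by
    rw [hunion]
    exact (Finset.finite_toSet _).preimage F.injective.injOn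
  have hcard := Set.ncard_union_add_ncard_inter U₁ U₂
    (hfin.subset Set.subset_union_left) (hfin.subset Set.subset_union_right)
  rw [hinter, hunion, Set.ncard_preimage_of_injective_subset_range F.injective (by simp),
    Set.ncard_coe_finset, Finset.card_product,
    ncard_graphColorings_compl_singleton, ncard_graphColorings_compl_singleton] at hcard
  rw [completeCount, hG, pow_two, two_mul, ← hcard, add_comm]

/-- The sign of `τ`, the numbers of cycles of `σ` and `τ`, and the number of intersecting pairs
of cycles. -/
def factorizationType {k : ℕ} (σ τ : Equiv.Perm (Fin k)) : ℤ × ℕ × ℕ × ℕ :=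
  (Equiv.Perm.sign τ, cycleCount σ, cycleCount τ, edgeCount σ τ)

theorem edgeCount_eq_ncard {k : ℕ} {ι κ : Type*} {σ τ : Equiv.Perm (Fin k)}
    {u : Fin k → ι} {v : Fin k → κ} (hu : IsCycleLabelling σ u) (hv : IsCycleLabelling τ v) :
    edgeCount σ τ = (Set.range fun a => (u a, v a)).ncard := by
  rw [edgeCount, ← Set.ncard_coe_finset, Finset.coe_image, Finset.coe_univ, Set.image_univ]
  choose r hr using hu.1
  choose t ht using hv.1
  symm
  refine Set.ncard_congr (fun e _ => (cycleLabel σ (r e.1), cycleLabel τ (t e.2))) ?_ ?_ ?_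
  · rintro _ ⟨a, rfl⟩
    exact ⟨a, by simp [cycleLabel_eq_iff, ← hu.2, ← hv.2, hr, ht]⟩
  · intro e e' _ _ h
    simpa [cycleLabel_eq_iff, ← hu.2, ← hv.2, hr, ht, Prod.ext_iff] using h
  · rintro _ ⟨a, rfl⟩
    exact ⟨(u a, v a), ⟨a, rfl⟩, by simp [cycleLabel_eq_iff, ← hu.2, ← hv.2, hr, ht]⟩

theorem Ncolorings_eq_completeCount {k p q : ℕ} (μ : YoungDiagram) {σ τ : Equiv.Perm (Fin k)}
    (hσ : cycleCount σ = p) (hτ : cycleCount τ = q) (hE : edgeCount σ τ = p * q) :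
    Ncolorings μ τ σ = completeCount μ p q := by
  obtain ⟨u, hu⟩ := exists_isCycleLabelling σ hσ
  obtain ⟨v, hv⟩ := exists_isCycleLabelling τ hτ
  rw [edgeCount_eq_ncard hu hv] at hE
  have huniv : (Set.range fun a => (u a, v a)) = Set.univ :=
    Set.eq_of_subset_of_ncard_le (Set.subset_univ _) (by simp [Set.ncard_univ, hE])
  rw [Ncolorings_eq_ncard μ hu hv, completeCount, huniv]

theorem Ncolorings_eq_pathCount {k : ℕ} (μ : YoungDiagram) {σ τ : Equiv.Perm (Fin k)}
    (hσ : cycleCount σ = 2) (hτ : cycleCount τ = 2) (hE : edgeCount σ τ = 3) :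
    Ncolorings μ τ σ = pathCount μ := by
  obtain ⟨u, hu⟩ := exists_isCycleLabelling σ hσ
  obtain ⟨v, hv⟩ := exists_isCycleLabelling τ hτ
  rw [edgeCount_eq_ncard hu hv] at hE
  rw [Ncolorings_eq_ncard μ hu hv]
  have hcompl := Set.ncard_add_ncard_compl (Set.range fun a => (u a, v a))
  rw [hE] at hcompl
  obtain ⟨e, he⟩ := Set.ncard_eq_one.1 (show (Set.range fun a => (u a, v a))ᶜ.ncard = 1 by
    simp at hcompl; omega)
  rw [← compl_compl (Set.range fun a => (u a, v a)), he, ncard_graphColorings_compl_singleton]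

/-- The signed number of colorings attached to a factorization of the given type, for types
whose intersection graph is complete bipartite or a path with three edges. -/
noncomputable def typeValue (μ : YoungDiagram) (t : ℤ × ℕ × ℕ × ℕ) : ℚ :=
  t.1 * (if t.2.2.2 = t.2.1 * t.2.2.1 then completeCount μ t.2.1 t.2.2.1 else pathCount μ : ℕ)

theorem sign_mul_Ncolorings_eq_typeValue {k : ℕ} (μ : YoungDiagram) (σ τ : Equiv.Perm (Fin k))
    (h : edgeCount σ τ = cycleCount σ * cycleCount τ ∨
      (cycleCount σ = 2 ∧ cycleCount τ = 2 ∧ edgeCount σ τ = 3)) :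
    ((Equiv.Perm.sign τ : ℤ) : ℚ) * Ncolorings μ τ σ = typeValue μ (factorizationType σ τ) := by
  change _ = ((Equiv.Perm.sign τ : ℤ) : ℚ) * ((if edgeCount σ τ = cycleCount σ * cycleCount τ
    then completeCount μ (cycleCount σ) (cycleCount τ) else pathCount μ : ℕ) : ℚ)
  rcases h with h | ⟨h1, h2, h3⟩
  · rw [if_pos h, Ncolorings_eq_completeCount μ rfl rfl h]
  · rw [if_neg (by rw [h1, h2, h3]; norm_num), Ncolorings_eq_pathCount μ h1 h2 h3]

theorem factorizationTypes_three :
    (Finset.univ.val.map fun σ : Equiv.Perm (Fin 3) =>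
      factorizationType σ (σ⁻¹ * (finRotate 3)⁻¹)) =
    {(1, 3, 1, 3), (1, 1, 3, 3), (1, 1, 1, 1)} + Multiset.replicate 3 (-1, 2, 2, 3) := by
  decide +kernel

theorem factorizationTypes_five :
    (Finset.univ.val.map fun σ : Equiv.Perm (Fin 5) =>
      factorizationType σ (σ⁻¹ * (finRotate 5)⁻¹)) =
    {(1, 5, 1, 5), (1, 1, 5, 5)} + Multiset.replicate 10 (-1, 4, 2, 5) +
      Multiset.replicate 10 (-1, 2, 4, 5) + Multiset.replicate 20 (1, 3, 3, 5) +
      Multiset.replicate 15 (1, 3, 1, 3) + Multiset.replicate 15 (1, 1, 3, 3) +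
      Multiset.replicate 35 (-1, 2, 2, 3) + Multiset.replicate 5 (-1, 2, 2, 4) +
      Multiset.replicate 8 (1, 1, 1, 1) := by
  decide +kernel

theorem freeCumulant_two (μ : YoungDiagram) : freeCumulant μ 2 = completeCount μ 1 1 := by
  rw [freeCumulant_eq_sum, Fintype.sum_unique (ι := Equiv.Perm (Fin 1))]
  have h1 : ∀ σ : Equiv.Perm (Fin 1), cycleCount σ = 1 := by decide
  have h2 : ∀ σ τ : Equiv.Perm (Fin 1), edgeCount σ τ = 1 * 1 := by decide
  have h3 : ∀ σ : Equiv.Perm (Fin 1), Equiv.Perm.sign σ = 1 := by decide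
  rw [if_pos (by rw [h1, h1]), Ncolorings_eq_completeCount μ (h1 _) (h1 _) (h2 _ _), h3]
  simp

theorem freeCumulant_four (μ : YoungDiagram) :
    freeCumulant μ 4 = completeCount μ 3 1 + completeCount μ 1 3 - 3 * pathCount μ := by
  have h : freeCumulant μ 4 = ((Finset.univ.val.map fun σ : Equiv.Perm (Fin 3) =>
      factorizationType σ (σ⁻¹ * (finRotate 3)⁻¹)).map fun t =>
        if t.2.1 + t.2.2.1 = 4 then typeValue μ t else 0).sum := by
    rw [freeCumulant_eq_sum, Multiset.map_map, ← Finset.sum_eq_multiset_sum]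
    refine Finset.sum_congr rfl fun σ _ => ?_
    have hmem := Multiset.mem_map_of_mem (fun σ : Equiv.Perm (Fin 3) =>
      factorizationType σ (σ⁻¹ * (finRotate 3)⁻¹)) (Finset.mem_univ_val σ)
    rw [factorizationTypes_three] at hmem
    refine if_congr Iff.rfl (sign_mul_Ncolorings_eq_typeValue μ _ _ ?_) rfl
    exact (by decide : ∀ t ∈ ({(1, 3, 1, 3), (1, 1, 3, 3), (1, 1, 1, 1)} +
      Multiset.replicate 3 (-1, 2, 2, 3) : Multiset (ℤ × ℕ × ℕ × ℕ)),
      t.2.2.2 = t.2.1 * t.2.2.1 ∨ (t.2.1 = 2 ∧ t.2.2.1 = 2 ∧ t.2.2.2 = 3)) _ hmem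
  rw [h, factorizationTypes_three]
  simp [typeValue]
  ring

theorem SigmaCycle_five_sub_freeCumulant_six (μ : YoungDiagram) :
    SigmaCycle μ 5 - freeCumulant μ 6 = 15 * completeCount μ 3 1 + 15 * completeCount μ 1 3
      - 35 * pathCount μ - 5 * completeCount μ 2 2 + 8 * completeCount μ 1 1 := by
  have h : SigmaCycle μ 5 - freeCumulant μ 6 =
      ((Finset.univ.val.map fun σ : Equiv.Perm (Fin 5) =>
        factorizationType σ (σ⁻¹ * (finRotate 5)⁻¹)).map fun t =>
        if t.2.1 + t.2.2.1 = 6 then 0 else typeValue μ t).sum := by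
    rw [SigmaCycle_eq_sum, freeCumulant_eq_sum, Multiset.map_map, ← Finset.sum_eq_multiset_sum,
      ← Finset.sum_sub_distrib]
    refine Finset.sum_congr rfl fun σ _ => ?_
    have hmem := Multiset.mem_map_of_mem (fun σ : Equiv.Perm (Fin 5) =>
      factorizationType σ (σ⁻¹ * (finRotate 5)⁻¹)) (Finset.mem_univ_val σ)
    rw [factorizationTypes_five] at hmem
    simp only [Function.comp_apply]
    change _ - (if cycleCount σ + cycleCount (σ⁻¹ * (finRotate 5)⁻¹) = 6 then _ else _) =
      if cycleCount σ + cycleCount (σ⁻¹ * (finRotate 5)⁻¹) = 6 then _ else _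
    split_ifs with h6
    · exact sub_self _
    · rw [sub_zero]
      refine sign_mul_Ncolorings_eq_typeValue μ _ _ ?_
      refine (?_ : ∀ t : ℤ × ℕ × ℕ × ℕ, t ∈ _ → t.2.1 + t.2.2.1 ≠ 6 →
        t.2.2.2 = t.2.1 * t.2.2.1 ∨ (t.2.1 = 2 ∧ t.2.2.1 = 2 ∧ t.2.2.2 = 3)) _ hmem h6
      decide +kernel
  rw [h, factorizationTypes_five]
  simp [typeValue]
  ring

/-- For every Young diagram `μ`, `Σ_5^μ = R_6^μ + 15·R_4^μ + 5·(R_2^μ)² + 8·R_2^μ`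
(the Kerov polynomial `K_5` is `R_6 + 15R_4 + 5R_2² + 8R_2`). -/
theorem kerov_K5 (μ : YoungDiagram) :
    SigmaCycle μ 5 = freeCumulant μ 6 + 15 * freeCumulant μ 4
      + 5 * freeCumulant μ 2 ^ 2 + 8 * freeCumulant μ 2 := by
  have h1 := SigmaCycle_five_sub_freeCumulant_six μ
  have h2 : (completeCount μ 2 2 : ℚ) + (completeCount μ 1 1 : ℚ) ^ 2 = 2 * pathCount μ := by
    exact_mod_cast card_completeCount_inclusion_exclusion μ
  rw [freeCumulant_four, freeCumulant_two]
  linear_combination h1 - 5 * h2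

end AsympRep
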